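/- Let H be a quasi-Hopf algebra over a field k with bijective antipode S (inverse S̄), μ : H → k an algebra map, and let U^L = f̄1S(q^R_2) ⊗ f̄2S(q^R_1), V^L = S̄(f2 p^R_2) ⊗ S̄(f1 p^R_1) (with f the Drinfeld twist). If λ ∈ H* satisfies V^L_1 h_(1) U^L_1 · ⟨λ, V^L_2 h_(2) U^L_2⟩ = μ(φ̄1)·⟨λ, hS(φ̄2)⟩·φ̄3 for all h ∈ H, then λ also satisfies q^R_1 h_(1) p^R_1 · ⟨λ, q^R_2 h_(2) p^R_2⟩ = μ(φ̄1)·⟨λ, S̄(q^L_1) h S(φ̄2 p^L_1)⟩ · q^L_2 φ̄3 p^L_2 for all h ∈ H. -/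

import Mathlib

open scoped TensorProduct

noncomputable section

/-- A quasi-Hopf algebra over a field `k`, presented together with explicit
(Sweedler-style) finite representations of the comultiplication and of the
associator `φ` and its inverse `φ⁻¹`.  The fields `n, d1, d2` give, for every
`h : H`, a finite family with `Δ h = ∑ i < n h, d1 h i ⊗ d2 h i`; similarly
`P1, P2, P3` (resp. `Q1, Q2, Q3`) are the components of `φ` (resp. `φ⁻¹`). -/
structure QuasiHopf (k H : Type) [Field k] [Ring H] [Algebra k H] where
  comul : H →ₐ[k] H ⊗[k] H
  counit : H →ₐ[k] k
  n : H → ℕ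
  d1 : H → ℕ → H
  d2 : H → ℕ → H
  comul_eq : ∀ h, comul h = ∑ i ∈ Finset.range (n h), d1 h i ⊗ₜ[k] d2 h i
  np : ℕ
  P1 : ℕ → H
  P2 : ℕ → H
  P3 : ℕ → H
  nq : ℕ
  Q1 : ℕ → H
  Q2 : ℕ → H
  Q3 : ℕ → H
  S : H →ₗ[k] H
  Sinv : H →ₗ[k] H
  alpha : H
  beta : H
  S_one : S 1 = 1
  S_mul : ∀ x y : H, S (x * y) = S y * S x
  Sinv_S : ∀ x : H, Sinv (S x) = x
  S_Sinv : ∀ x : H, S (Sinv x) = x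
  phi_phiInv :
    (∑ a ∈ Finset.range np, P1 a ⊗ₜ[k] (P2 a ⊗ₜ[k] P3 a)) *
      (∑ b ∈ Finset.range nq, Q1 b ⊗ₜ[k] (Q2 b ⊗ₜ[k] Q3 b)) = 1
  phiInv_phi :
    (∑ b ∈ Finset.range nq, Q1 b ⊗ₜ[k] (Q2 b ⊗ₜ[k] Q3 b)) *
      (∑ a ∈ Finset.range np, P1 a ⊗ₜ[k] (P2 a ⊗ₜ[k] P3 a)) = 1
  qcoassoc : ∀ h : H,
    ∑ i ∈ Finset.range (n h), d1 h i ⊗ₜ[k] comul (d2 h i) =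
      (∑ a ∈ Finset.range np, P1 a ⊗ₜ[k] (P2 a ⊗ₜ[k] P3 a)) *
        (∑ i ∈ Finset.range (n h), ∑ j ∈ Finset.range (n (d1 h i)),
          d1 (d1 h i) j ⊗ₜ[k] (d2 (d1 h i) j ⊗ₜ[k] d2 h i)) *
        (∑ b ∈ Finset.range nq, Q1 b ⊗ₜ[k] (Q2 b ⊗ₜ[k] Q3 b))
  counit_left : ∀ h : H, ∑ i ∈ Finset.range (n h), counit (d1 h i) • d2 h i = h
  counit_right : ∀ h : H, ∑ i ∈ Finset.range (n h), counit (d2 h i) • d1 h i = h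
  pentagon :
    (∑ a ∈ Finset.range np, P1 a ⊗ₜ[k] (P2 a ⊗ₜ[k] comul (P3 a))) *
      (∑ a ∈ Finset.range np, ∑ i ∈ Finset.range (n (P1 a)),
        d1 (P1 a) i ⊗ₜ[k] (d2 (P1 a) i ⊗ₜ[k] (P2 a ⊗ₜ[k] P3 a))) =
    ((1 : H) ⊗ₜ[k] (∑ a ∈ Finset.range np, P1 a ⊗ₜ[k] (P2 a ⊗ₜ[k] P3 a))) *
      (∑ a ∈ Finset.range np, ∑ i ∈ Finset.range (n (P2 a)),
        P1 a ⊗ₜ[k] (d1 (P2 a) i ⊗ₜ[k] (d2 (P2 a) i ⊗ₜ[k] P3 a))) *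
      (∑ a ∈ Finset.range np, P1 a ⊗ₜ[k] (P2 a ⊗ₜ[k] (P3 a ⊗ₜ[k] (1 : H))))
  counit_mid_phi :
    ∑ a ∈ Finset.range np, counit (P2 a) • (P1 a ⊗ₜ[k] P3 a) = (1 : H) ⊗ₜ[k] (1 : H)
  antipode_alpha : ∀ h : H,
    ∑ i ∈ Finset.range (n h), S (d1 h i) * alpha * d2 h i = counit h • alpha
  antipode_beta : ∀ h : H,
    ∑ i ∈ Finset.range (n h), d1 h i * beta * S (d2 h i) = counit h • beta
  nondeg_1 : ∑ a ∈ Finset.range np, P1 a * beta * S (P2 a) * alpha * P3 a = 1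
  nondeg_2 : ∑ b ∈ Finset.range nq, S (Q1 b) * alpha * Q2 b * beta * S (Q3 b) = 1
  counit_alpha : counit alpha = 1
  counit_beta : counit beta = 1

namespace QuasiHopf

variable {k H : Type} [Field k] [Ring H] [Algebra k H] (q : QuasiHopf k H)

/-- The associator `φ` as an element of `H ⊗ H ⊗ H`. -/
def Phi : H ⊗[k] (H ⊗[k] H) :=
  ∑ a ∈ Finset.range q.np, q.P1 a ⊗ₜ[k] (q.P2 a ⊗ₜ[k] q.P3 a)

/-- `φ⁻¹` as an element of `H ⊗ H ⊗ H`. -/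
def PhiInv : H ⊗[k] (H ⊗[k] H) :=
  ∑ b ∈ Finset.range q.nq, q.Q1 b ⊗ₜ[k] (q.Q2 b ⊗ₜ[k] q.Q3 b)

/-- first components of `p^R = φ̄1 ⊗ φ̄2 β S(φ̄3)` -/
def pR1 (b : ℕ) : H := q.Q1 b

def pR2 (b : ℕ) : H := q.Q2 b * q.beta * q.S (q.Q3 b)

def pRE : H ⊗[k] H := ∑ b ∈ Finset.range q.nq, q.pR1 b ⊗ₜ[k] q.pR2 b

/-- components of `q^R = φ1 ⊗ S̄(α φ3) φ2` -/
def qR1 (a : ℕ) : H := q.P1 a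

def qR2 (a : ℕ) : H := q.Sinv (q.alpha * q.P3 a) * q.P2 a

def qRE : H ⊗[k] H := ∑ a ∈ Finset.range q.np, q.qR1 a ⊗ₜ[k] q.qR2 a

/-- components of `p^L = φ2 S̄(φ1 β) ⊗ φ3` -/
def pL1 (a : ℕ) : H := q.P2 a * q.Sinv (q.P1 a * q.beta)

def pL2 (a : ℕ) : H := q.P3 a

def pLE : H ⊗[k] H := ∑ a ∈ Finset.range q.np, q.pL1 a ⊗ₜ[k] q.pL2 a

/-- components of `q^L = S(φ̄1) α φ̄2 ⊗ φ̄3` -/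
def qL1 (b : ℕ) : H := q.S (q.Q1 b) * q.alpha * q.Q2 b

def qL2 (b : ℕ) : H := q.Q3 b

def qLE : H ⊗[k] H := ∑ b ∈ Finset.range q.nq, q.qL1 b ⊗ₜ[k] q.qL2 b

/-- `𝕒 = S(φ̄1 φ2) α φ̄2 φ3₍₁₎ ⊗ S(φ1) α φ̄3 φ3₍₂₎` -/
def aEl : H ⊗[k] H :=
  ∑ a ∈ Finset.range q.np, ∑ b ∈ Finset.range q.nq, ∑ m ∈ Finset.range (q.n (q.P3 a)),
    (q.S (q.Q1 b * q.P2 a) * q.alpha * q.Q2 b * q.d1 (q.P3 a) m) ⊗ₜ[k]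
      (q.S (q.P1 a) * q.alpha * q.Q3 b * q.d2 (q.P3 a) m)

/-- `𝕓 = φ1₍₁₎ φ̄1 β S(φ3) ⊗ φ1₍₂₎ φ̄2 β S(φ2 φ̄3)` -/
def bEl : H ⊗[k] H :=
  ∑ a ∈ Finset.range q.np, ∑ b ∈ Finset.range q.nq, ∑ m ∈ Finset.range (q.n (q.P1 a)),
    (q.d1 (q.P1 a) m * q.Q1 b * q.beta * q.S (q.P3 a)) ⊗ₜ[k]
      (q.d2 (q.P1 a) m * q.Q2 b * q.beta * q.S (q.P2 a * q.Q3 b))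

/-- `(S ⊗ S)(Δ^cop x) = S(x₍₂₎) ⊗ S(x₍₁₎)` -/
def scop (x : H) : H ⊗[k] H :=
  ∑ m ∈ Finset.range (q.n x), q.S (q.d2 x m) ⊗ₜ[k] q.S (q.d1 x m)

/-- The Drinfeld twist `f = (S⊗S)(Δ^cop(p^R_1)) · 𝕒 · Δ(p^R_2)`. -/
def twist : H ⊗[k] H :=
  ∑ b ∈ Finset.range q.nq, q.scop (q.pR1 b) * q.aEl * q.comul (q.pR2 b)

/-- `f⁻¹ = Δ(q^L_1) · 𝕓 · (S⊗S)(Δ^cop(q^L_2))`. -/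
def twistInv : H ⊗[k] H :=
  ∑ b ∈ Finset.range q.nq, q.comul (q.qL1 b) * q.bEl * q.scop (q.qL2 b)

/-- `x ⊗ y ↦ S y ⊗ S x` -/
def sswap : H ⊗[k] H →ₗ[k] H ⊗[k] H :=
  (TensorProduct.map q.S q.S).comp (TensorProduct.comm k H H).toLinearMap

/-- `x ⊗ y ↦ S̄ y ⊗ S̄ x` -/
def sswapInv : H ⊗[k] H →ₗ[k] H ⊗[k] H :=
  (TensorProduct.map q.Sinv q.Sinv).comp (TensorProduct.comm k H H).toLinearMap

/-- `U^L = f̄1 S(q^R_2) ⊗ f̄2 S(q^R_1)` -/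
def UL : H ⊗[k] H := q.twistInv * q.sswap q.qRE

/-- `V^L = S̄(f2 p^R_2) ⊗ S̄(f1 p^R_1)` -/
def VL : H ⊗[k] H := q.sswapInv (q.twist * q.pRE)

/-- `U^R = S̄(q^L_2 f̄2) ⊗ S̄(q^L_1 f̄1)` -/
def UR : H ⊗[k] H := q.sswapInv (q.qLE * q.twistInv)

/-- `V^R = S(p^L_2) f1 ⊗ S(p^L_1) f2` -/
def VR : H ⊗[k] H := q.sswap q.pLE * q.twist

/-- `h ↦ h ↼ μ = μ(h₍₁₎) h₍₂₎` -/
def lhook (mu : H →ₐ[k] k) : H →ₗ[k] H :=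
  (TensorProduct.lid k H).toLinearMap.comp
    ((TensorProduct.map mu.toLinearMap LinearMap.id).comp q.comul.toLinearMap)

/-- `h ↦ μ ⇀ h = μ(h₍₂₎) h₍₁₎` -/
def rhook (mu : H →ₐ[k] k) : H →ₗ[k] H :=
  (TensorProduct.rid k H).toLinearMap.comp
    ((TensorProduct.map LinearMap.id mu.toLinearMap).comp q.comul.toLinearMap)

/-- `W^L = μ(φ̄1) f̄1 S(q^R_2 φ̄3) ⊗ f̄2 S((q^R_1 ↼ μ) φ̄2)` -/
def WL (mu : H →ₐ[k] k) : H ⊗[k] H :=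
  q.twistInv * q.sswap ((TensorProduct.map (q.lhook mu) LinearMap.id q.qRE) *
    (∑ b ∈ Finset.range q.nq, mu (q.Q1 b) • (q.Q2 b ⊗ₜ[k] q.Q3 b)))

/-- `W^R = μ(φ3) S̄((μ ⇀ q^L_2) φ2 f̄2) ⊗ S̄(q^L_1 φ1 f̄1)` -/
def WR (mu : H →ₐ[k] k) : H ⊗[k] H :=
  q.sswapInv ((TensorProduct.map LinearMap.id (q.rhook mu) q.qLE) *
    (∑ a ∈ Finset.range q.np, mu (q.P3 a) • (q.P1 a ⊗ₜ[k] q.P2 a)) * q.twistInv)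

section Modules

variable {V W X : Type} [AddCommGroup V] [Module k V] [AddCommGroup W] [Module k W]
  [AddCommGroup X] [Module k X]

/-- The tensor-product action `h · (v ⊗ w) = h₍₁₎ v ⊗ h₍₂₎ w`. -/
def tensAct (ρV : H → Module.End k V) (ρW : H → Module.End k W) (h : H) :
    Module.End k (V ⊗[k] W) :=
  ∑ i ∈ Finset.range (q.n h), TensorProduct.map (ρV (q.d1 h i)) (ρW (q.d2 h i))

/-- The action on the left dual: `(h · ξ)(x) = ξ(S(h) x)`. -/
def dualAct (ρX : H → Module.End k X) (h : H) : Module.End k (Module.Dual k X) :=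
  LinearMap.dualMap (ρX (q.S h))

end Modules

end QuasiHopf

/-- `f` intertwines the two given `H`-actions. -/
def IsHLin {k H V W : Type} [Field k] [Ring H] [Algebra k H]
    [AddCommGroup V] [Module k V] [AddCommGroup W] [Module k W]
    (ρV : H → Module.End k V) (ρW : H → Module.End k W) (f : V →ₗ[k] W) : Prop :=
  ∀ (h : H) (v : V), f (ρV h v) = ρW h (f v)

/-- `x ⊗ y ↦ λ(y) • x` -/
def hitR {k H : Type} [Field k] [Ring H] [Algebra k H] (lam : H →ₗ[k] k) :
    H ⊗[k] H →ₗ[k] H :=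
  (TensorProduct.rid k H).toLinearMap.comp (TensorProduct.map LinearMap.id lam)

/-- `x ⊗ y ↦ λ(x) • y` -/
def hitL {k H : Type} [Field k] [Ring H] [Algebra k H] (lam : H →ₗ[k] k) :
    H ⊗[k] H →ₗ[k] H :=
  (TensorProduct.lid k H).toLinearMap.comp (TensorProduct.map lam LinearMap.id)

namespace QuasiHopf

variable {k H : Type} [Field k] [Ring H] [Algebra k H] (q : QuasiHopf k H)

set_option maxSynthPendingDepth 10

section Induction

variable (k)

theorem tensor_induction₂ {P : H ⊗[k] H → Prop} (tmul : ∀ a b : H, P (a ⊗ₜ b))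
    (add : ∀ u v, P u → P v → P (u + v)) (u) : P u := by
  induction u using TensorProduct.induction_on with
  | zero => simpa using tmul 0 0
  | tmul a b => exact tmul a b
  | add u v hu hv => exact add u v hu hv

theorem tensor_induction₃ {P : H ⊗[k] (H ⊗[k] H) → Prop}
    (tmul : ∀ a b c : H, P (a ⊗ₜ (b ⊗ₜ c)))
    (add : ∀ u v, P u → P v → P (u + v)) (u) : P u := by
  induction u using TensorProduct.induction_on with
  | zero => simpa using tmul 0 0 0
  | tmul a b =>
    exact tensor_induction₂ k (P := fun b ↦ P (a ⊗ₜ b)) (tmul a)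
      (fun u v hu hv ↦ by simpa only [TensorProduct.tmul_add] using add _ _ hu hv) b
  | add u v hu hv => exact add u v hu hv

theorem tensor_induction₄ {P : H ⊗[k] (H ⊗[k] (H ⊗[k] H)) → Prop}
    (tmul : ∀ a b c d : H, P (a ⊗ₜ (b ⊗ₜ (c ⊗ₜ d))))
    (add : ∀ u v, P u → P v → P (u + v)) (u) : P u := by
  induction u using TensorProduct.induction_on with
  | zero => simpa using tmul 0 0 0 0
  | tmul a b =>
    exact tensor_induction₃ k (P := fun b ↦ P (a ⊗ₜ b)) (tmul a)
      (fun u v hu hv ↦ by simpa only [TensorProduct.tmul_add] using add _ _ hu hv) b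
  | add u v hu hv => exact add u v hu hv

theorem tensor_induction₅ {P : H ⊗[k] (H ⊗[k] (H ⊗[k] (H ⊗[k] H))) → Prop}
    (tmul : ∀ a b c d e : H, P (a ⊗ₜ (b ⊗ₜ (c ⊗ₜ (d ⊗ₜ e)))))
    (add : ∀ u v, P u → P v → P (u + v)) (u) : P u := by
  induction u using TensorProduct.induction_on with
  | zero => simpa using tmul 0 0 0 0 0
  | tmul a b =>
    exact tensor_induction₄ k (P := fun b ↦ P (a ⊗ₜ b)) (tmul a)
      (fun u v hu hv ↦ by simpa only [TensorProduct.tmul_add] using add _ _ hu hv) b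
  | add u v hu hv => exact add u v hu hv

end Induction

section Structure

variable {M N : Type} [Ring M] [Algebra k M] [Ring N] [Algebra k N]

/-- `id ⊗ g` for an algebra map `g`. -/
def under (g : M →ₐ[k] N) : H ⊗[k] M →ₐ[k] H ⊗[k] N :=
  Algebra.TensorProduct.map (AlgHom.id k H) g

@[simp] theorem under_tmul (g : M →ₐ[k] N) (x : H) (m : M) :
    under g (x ⊗ₜ[k] m) = x ⊗ₜ[k] g m := rfl

variable (M) in
/-- `Δ ⊗ id`, reassociated to the right. -/
def dHead : H ⊗[k] M →ₐ[k] H ⊗[k] (H ⊗[k] M) :=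
  (Algebra.TensorProduct.assoc k k k H H M).toAlgHom.comp
    (Algebra.TensorProduct.map q.comul (AlgHom.id k M))

theorem dHead_tmul (x : H) (m : M) : q.dHead M (x ⊗ₜ[k] m) =
    ∑ i ∈ Finset.range (q.n x), q.d1 x i ⊗ₜ[k] (q.d2 x i ⊗ₜ[k] m) := by
  simp [dHead, q.comul_eq x, TensorProduct.sum_tmul]

variable (M) in
/-- `ε ⊗ id`. -/
def eHead : H ⊗[k] M →ₐ[k] M :=
  (Algebra.TensorProduct.lid k M).toAlgHom.comp
    (Algebra.TensorProduct.map q.counit (AlgHom.id k M))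

@[simp] theorem eHead_tmul (x : H) (m : M) : q.eHead M (x ⊗ₜ[k] m) = q.counit x • m := by
  simp [eHead]

/-- `id ⊗ ε`. -/
def eLast : H ⊗[k] H →ₐ[k] H :=
  (Algebra.TensorProduct.rid k k H).toAlgHom.comp
    (Algebra.TensorProduct.map (AlgHom.id k H) q.counit)

@[simp] theorem eLast_tmul (x y : H) : q.eLast (x ⊗ₜ[k] y) = q.counit y • x := by
  simp [eLast]

/-- `m ↦ 1 ⊗ m`. -/
def consOne (k H M : Type) [Field k] [Ring H] [Algebra k H] [Ring M] [Algebra k M] :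
    M →ₐ[k] H ⊗[k] M :=
  Algebra.TensorProduct.includeRight

@[simp] theorem consOne_apply (m : M) : consOne k H M m = 1 ⊗ₜ[k] m := rfl

/-- `x ↦ x ⊗ 1`. -/
def snocOne (k H M : Type) [Field k] [Ring H] [Algebra k H] [Ring M] [Algebra k M] :
    H →ₐ[k] H ⊗[k] M :=
  Algebra.TensorProduct.includeLeft

@[simp] theorem snocOne_apply (x : H) : snocOne k H M x = x ⊗ₜ[k] 1 := rfl

theorem eLast_comul (x : H) : q.eLast (q.comul x) = x := by
  conv_rhs => rw [← q.counit_right x]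
  rw [q.comul_eq]; simp

theorem eHead_comul (x : H) : q.eHead H (q.comul x) = x := by
  conv_rhs => rw [← q.counit_left x]
  rw [q.comul_eq]; simp

theorem eHead_dHead (u : H ⊗[k] M) : q.eHead (H ⊗[k] M) (q.dHead M u) = u := by
  induction u using TensorProduct.induction_on with
  | zero => simp
  | tmul x m =>
    conv_rhs => rw [← q.counit_left x]
    simp [dHead_tmul, TensorProduct.sum_tmul, TensorProduct.smul_tmul']
  | add u v hu hv => rw [map_add, map_add, hu, hv]

theorem under_eHead_dHead (u : H ⊗[k] M) : under (q.eHead M) (q.dHead M u) = u := by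
  induction u using TensorProduct.induction_on with
  | zero => simp
  | tmul x m =>
    conv_rhs => rw [← q.counit_right x]
    simp [dHead_tmul, TensorProduct.sum_tmul, TensorProduct.smul_tmul]
  | add u v hu hv => rw [map_add, map_add, hu, hv]

theorem Phi_mul_PhiInv : q.Phi * q.PhiInv = 1 := q.phi_phiInv

theorem PhiInv_mul_Phi : q.PhiInv * q.Phi = 1 := q.phiInv_phi

theorem under_comul_comul (x : H) :
    under q.comul (q.comul x) = q.Phi * q.dHead H (q.comul x) * q.PhiInv := by
  have h := q.qcoassoc x
  rw [q.comul_eq x]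
  simp only [map_sum, under_tmul, dHead_tmul]
  exact h

theorem PhiInv_mul_under_comul (x : H) :
    q.PhiInv * under q.comul (q.comul x) = q.dHead H (q.comul x) * q.PhiInv := by
  rw [under_comul_comul, ← mul_assoc, ← mul_assoc, PhiInv_mul_Phi, one_mul]

theorem Phi_mul_dHead (x : H) :
    q.Phi * q.dHead H (q.comul x) = under q.comul (q.comul x) * q.Phi := by
  rw [under_comul_comul, mul_assoc _ _ q.Phi, PhiInv_mul_Phi, mul_one]

theorem pentagon_Phi :
    under (under q.comul) q.Phi * q.dHead (H ⊗[k] H) q.Phi =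
      consOne k H _ q.Phi * under (q.dHead H) q.Phi * under (under (snocOne k H H)) q.Phi := by
  have h := q.pentagon
  simp only [Phi, map_sum, under_tmul, dHead_tmul, consOne_apply, snocOne_apply,
    TensorProduct.tmul_sum] at h ⊢
  exact h

theorem map_Phi_mul_map_PhiInv {A : Type} [Ring A] [Algebra k A]
    (g : H ⊗[k] (H ⊗[k] H) →ₐ[k] A) : g q.Phi * g q.PhiInv = 1 := by
  rw [← map_mul, Phi_mul_PhiInv, map_one]

theorem map_PhiInv_eq_one {A : Type} [Ring A] [Algebra k A]
    (g : H ⊗[k] (H ⊗[k] H) →ₐ[k] A) (h : g q.Phi = 1) : g q.PhiInv = 1 := by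
  simpa [h] using q.map_Phi_mul_map_PhiInv g

theorem under_eHead_Phi : under (q.eHead H) q.Phi = 1 := by
  have h := q.counit_mid_phi
  simpa [Phi, Algebra.TensorProduct.one_def] using h

end Structure

section Counit

variable {M N N' L : Type} [Ring M] [Algebra k M] [Ring N] [Algebra k N] [Ring N'] [Algebra k N']
  [Ring L] [Algebra k L]

theorem under_under_eq {g : N →ₐ[k] L} {h : M →ₐ[k] N} {g' : N' →ₐ[k] L} {h' : M →ₐ[k] N'}
    (H₀ : ∀ m, g (h m) = g' (h' m)) (u : H ⊗[k] M) :
    under g (under h u) = under g' (under h' u) := by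
  induction u using TensorProduct.induction_on with
  | zero => simp
  | tmul x m => simp [H₀]
  | add u v hu hv => simp only [map_add, hu, hv]

theorem under_under_eq_self {g : N →ₐ[k] M} {h : M →ₐ[k] N}
    (H₀ : ∀ m, g (h m) = m) (u : H ⊗[k] M) : under g (under h u) = u := by
  induction u using TensorProduct.induction_on with
  | zero => simp
  | tmul x m => simp [H₀]
  | add u v hu hv => simp only [map_add, hu, hv]

theorem eHead_under (g : M →ₐ[k] N) (u : H ⊗[k] M) :
    q.eHead N (under g u) = g (q.eHead M u) := by
  induction u using TensorProduct.induction_on with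
  | zero => simp
  | tmul x m => simp
  | add u v hu hv => simp only [map_add, hu, hv]

theorem dHead_under (g : M →ₐ[k] N) (u : H ⊗[k] M) :
    q.dHead N (under g u) = under (under g) (q.dHead M u) := by
  induction u using TensorProduct.induction_on with
  | zero => simp
  | tmul x m => simp [dHead_tmul]
  | add u v hu hv => simp only [map_add, hu, hv]

theorem eHead_Phi : q.eHead (H ⊗[k] H) q.Phi = 1 := by
  have h := congrArg (under (q.eHead (H ⊗[k] H))) q.pentagon_Phi
  have h₁ : under (q.eHead (H ⊗[k] H)) (under (under q.comul) q.Phi) = 1 := by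
    rw [under_under_eq (fun m ↦ q.eHead_under q.comul m), under_eHead_Phi, map_one]
  have h₂ : under (q.eHead (H ⊗[k] H)) (under (under (snocOne k H H)) q.Phi) = 1 := by
    rw [under_under_eq (fun m ↦ q.eHead_under (snocOne k H H) m), under_eHead_Phi, map_one]
  simp only [map_mul] at h
  rw [h₁, h₂, under_eHead_dHead, under_under_eq_self q.eHead_dHead, one_mul, mul_one,
    consOne_apply, under_tmul] at h
  have h₃ := congrArg (· * q.PhiInv) h
  simp only [mul_assoc, Phi_mul_PhiInv, mul_one] at h₃
  have h₄ := congrArg (q.eHead (H ⊗[k] H)) h₃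
  simpa using h₄.symm

theorem under_eLast_Phi : under q.eLast q.Phi = 1 := by
  have h := congrArg (under (under (q.eHead H))) q.pentagon_Phi
  have h₁ : under (under (q.eHead H)) (q.dHead (H ⊗[k] H) q.Phi) = 1 := by
    rw [← dHead_under, under_eHead_Phi, map_one]
  have h₂ : under (under (q.eHead H)) (under (under (snocOne k H H)) q.Phi) =
      under (snocOne k H H) (under q.eLast q.Phi) := by
    refine under_under_eq (fun m ↦ ?_) _
    induction m using tensor_induction₂ k with
    | tmul a b => simp
    | add u v hu hv => simp only [map_add, hu, hv]
  simp only [map_mul] at h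
  rw [h₁, h₂, under_under_eq_self (under_under_eq_self q.eHead_comul),
    under_under_eq_self q.under_eHead_dHead, mul_one, consOne_apply, under_tmul,
    under_eHead_Phi, ← Algebra.TensorProduct.one_def, one_mul] at h
  have h₃ := congrArg (q.PhiInv * ·) h
  simp only [← mul_assoc, PhiInv_mul_Phi, one_mul] at h₃
  have h₄ := congrArg (under q.eLast) h₃
  rw [under_under_eq_self (fun m ↦ by simp), map_one] at h₄
  exact h₄.symm

end Counit

section Contraction

variable (M : Type) [Ring M] [Algebra k M]

/-- `x ⊗ y ↦ x α y`. -/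
def mulAlpha : H ⊗[k] H →ₗ[k] H :=
  LinearMap.mul' k H ∘ₗ TensorProduct.map (LinearMap.mulRight k q.alpha) LinearMap.id

@[simp] theorem mulAlpha_tmul (x y : H) : q.mulAlpha (x ⊗ₜ[k] y) = x * q.alpha * y := rfl

/-- `x ⊗ y ↦ S(x) α y`. -/
def ctrA : H ⊗[k] H →ₗ[k] H := q.mulAlpha ∘ₗ TensorProduct.map q.S LinearMap.id

@[simp] theorem ctrA_tmul (x y : H) : q.ctrA (x ⊗ₜ[k] y) = q.S x * q.alpha * y := rfl

/-- `x ⊗ y ↦ x β S(y)`. -/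
def ctrB : H ⊗[k] H →ₗ[k] H :=
  LinearMap.mul' k H ∘ₗ TensorProduct.map (LinearMap.mulRight k q.beta) q.S

@[simp] theorem ctrB_tmul (x y : H) : q.ctrB (x ⊗ₜ[k] y) = x * q.beta * q.S y := rfl

/-- Apply a bilinear operation to the first two tensor factors. -/
def onHead (M : Type) [Ring M] [Algebra k M] (g : H ⊗[k] H →ₗ[k] H) :
    H ⊗[k] (H ⊗[k] M) →ₗ[k] H ⊗[k] M :=
  TensorProduct.map g LinearMap.id ∘ₗ (TensorProduct.assoc k H H M).symm.toLinearMap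

@[simp] theorem onHead_tmul (g : H ⊗[k] H →ₗ[k] H) (x y : H) (m : M) :
    onHead M g (x ⊗ₜ[k] (y ⊗ₜ[k] m)) = g (x ⊗ₜ[k] y) ⊗ₜ[k] m := rfl

/-- `x ⊗ y ⊗ z ⊗ t ↦ S(y) α z ⊗ S(x) α t`. -/
def ctrAA : H ⊗[k] (H ⊗[k] (H ⊗[k] H)) →ₗ[k] H ⊗[k] H :=
  TensorProduct.map LinearMap.id q.ctrA ∘ₗ (TensorProduct.leftComm k H H H).toLinearMap ∘ₗ
    TensorProduct.map LinearMap.id (onHead H q.ctrA)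

@[simp] theorem ctrAA_tmul (x y z t : H) :
    q.ctrAA (x ⊗ₜ[k] (y ⊗ₜ[k] (z ⊗ₜ[k] t))) =
      (q.S y * q.alpha * z) ⊗ₜ[k] (q.S x * q.alpha * t) := rfl

/-- `x ⊗ y ⊗ z ⊗ t ↦ x β S(t) ⊗ y β S(z)`. -/
def ctrBB : H ⊗[k] (H ⊗[k] (H ⊗[k] H)) →ₗ[k] H ⊗[k] H :=
  (TensorProduct.comm k H H).toLinearMap ∘ₗ TensorProduct.map LinearMap.id q.ctrB ∘ₗ
    (TensorProduct.leftComm k H H H).toLinearMap ∘ₗ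
    TensorProduct.map LinearMap.id (onHead H q.ctrB)

@[simp] theorem ctrBB_tmul (x y z t : H) :
    q.ctrBB (x ⊗ₜ[k] (y ⊗ₜ[k] (z ⊗ₜ[k] t))) =
      (x * q.beta * q.S t) ⊗ₜ[k] (y * q.beta * q.S z) := rfl

/-- `x ⊗ y ⊗ z ⊗ t ↦ x β S(y) α z ⊗ t`. -/
def ctrBAHead : H ⊗[k] (H ⊗[k] (H ⊗[k] H)) →ₗ[k] H ⊗[k] H :=
  onHead H q.mulAlpha ∘ₗ onHead (H ⊗[k] H) q.ctrB

@[simp] theorem ctrBAHead_tmul (x y z t : H) :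
    q.ctrBAHead (x ⊗ₜ[k] (y ⊗ₜ[k] (z ⊗ₜ[k] t))) =
      (x * q.beta * q.S y * q.alpha * z) ⊗ₜ[k] t := rfl

/-- `x ⊗ y ⊗ z ⊗ t ↦ x ⊗ y β S(z) α t`. -/
def ctrBATail : H ⊗[k] (H ⊗[k] (H ⊗[k] H)) →ₗ[k] H ⊗[k] H :=
  TensorProduct.map LinearMap.id (q.mulAlpha ∘ₗ onHead H q.ctrB)

@[simp] theorem ctrBATail_tmul (x y z t : H) :
    q.ctrBATail (x ⊗ₜ[k] (y ⊗ₜ[k] (z ⊗ₜ[k] t))) =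
      x ⊗ₜ[k] (y * q.beta * q.S z * q.alpha * t) := rfl

/-- `x ⊗ y ⊗ z ⊗ t ⊗ u ↦ S(y) α z ⊗ S(x) α t β S(u)`. -/
def ctrAAB : H ⊗[k] (H ⊗[k] (H ⊗[k] (H ⊗[k] H))) →ₗ[k] H ⊗[k] H :=
  TensorProduct.map LinearMap.id (q.ctrA ∘ₗ TensorProduct.map LinearMap.id q.ctrB) ∘ₗ
    (TensorProduct.leftComm k H H (H ⊗[k] H)).toLinearMap ∘ₗ
    TensorProduct.map LinearMap.id (onHead (H ⊗[k] H) q.ctrA)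

@[simp] theorem ctrAAB_tmul (x y z t u : H) :
    q.ctrAAB (x ⊗ₜ[k] (y ⊗ₜ[k] (z ⊗ₜ[k] (t ⊗ₜ[k] u)))) =
      (q.S y * q.alpha * z) ⊗ₜ[k] (q.S x * q.alpha * (t * q.beta * q.S u)) := rfl

/-- `x ⊗ y ⊗ z ⊗ t ⊗ u ↦ x β S(t) α u ⊗ y β S(z)`. -/
def ctrBAB : H ⊗[k] (H ⊗[k] (H ⊗[k] (H ⊗[k] H))) →ₗ[k] H ⊗[k] H :=
  (TensorProduct.comm k H H).toLinearMap ∘ₗ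
    TensorProduct.map LinearMap.id (q.mulAlpha ∘ₗ onHead H q.ctrB) ∘ₗ
    (TensorProduct.leftComm k H H (H ⊗[k] H)).toLinearMap ∘ₗ
    TensorProduct.map LinearMap.id (onHead (H ⊗[k] H) q.ctrB)

@[simp] theorem ctrBAB_tmul (x y z t u : H) :
    q.ctrBAB (x ⊗ₜ[k] (y ⊗ₜ[k] (z ⊗ₜ[k] (t ⊗ₜ[k] u)))) =
      (x * q.beta * q.S t * q.alpha * u) ⊗ₜ[k] (y * q.beta * q.S z) := rfl

theorem antipode_alpha_mul (h x y : H) :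
    ∑ i ∈ Finset.range (q.n h), q.S (q.d1 h i * x) * q.alpha * (q.d2 h i * y) =
      q.counit h • (q.S x * q.alpha * y) := by
  have h₁ := congrArg (fun z ↦ q.S x * z * y) (q.antipode_alpha h)
  simpa [Finset.mul_sum, Finset.sum_mul, q.S_mul, mul_assoc] using h₁

theorem antipode_beta_mul (h x y : H) :
    ∑ i ∈ Finset.range (q.n h), x * q.d1 h i * q.beta * q.S (y * q.d2 h i) =
      q.counit h • (x * q.beta * q.S y) := by
  have h₁ := congrArg (fun z ↦ x * z * q.S y) (q.antipode_beta h)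
  simpa [Finset.mul_sum, Finset.sum_mul, q.S_mul, mul_assoc] using h₁

end Contraction

section Sliding

/-- `m ↦ 1 ⊗ 1 ⊗ m`. -/
def consTwo (k H M : Type) [Field k] [Ring H] [Algebra k H] [Ring M] [Algebra k M] :
    M →ₐ[k] H ⊗[k] (H ⊗[k] M) :=
  (consOne k H (H ⊗[k] M)).comp (consOne k H M)

@[simp] theorem consTwo_apply {M : Type} [Ring M] [Algebra k M] (m : M) :
    consTwo k H M m = 1 ⊗ₜ[k] (1 ⊗ₜ[k] m) := rfl

theorem onHead_ctrA_dHead_mul (u : H ⊗[k] H) (t : H ⊗[k] (H ⊗[k] H)) :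
    onHead H q.ctrA (q.dHead H u * t) = (1 ⊗ₜ[k] q.eHead H u) * onHead H q.ctrA t := by
  induction u using tensor_induction₂ k with
  | tmul a b =>
    induction t using tensor_induction₃ k with
    | tmul x y z =>
      simp only [dHead_tmul, eHead_tmul, Finset.sum_mul, map_sum, onHead_tmul, ctrA_tmul,
        Algebra.TensorProduct.tmul_mul_tmul, one_mul, ← TensorProduct.sum_tmul,
        antipode_alpha_mul, TensorProduct.smul_tmul, smul_mul_assoc]
    | add u v hu hv => simp only [map_add, mul_add, hu, hv]
  | add u v hu hv => simp only [map_add, add_mul, TensorProduct.tmul_add, hu, hv]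

theorem map_ctrB_mul_under_comul (u : H ⊗[k] H) (t : H ⊗[k] (H ⊗[k] H)) :
    TensorProduct.map LinearMap.id q.ctrB (t * under q.comul u) =
      TensorProduct.map LinearMap.id q.ctrB t * (q.eLast u ⊗ₜ[k] 1) := by
  induction u using tensor_induction₂ k with
  | tmul a b =>
    induction t using tensor_induction₃ k with
    | tmul x y z =>
      simp only [under_tmul, q.comul_eq b, eLast_tmul, Finset.mul_sum, map_sum, ctrB_tmul,
        TensorProduct.tmul_sum, TensorProduct.map_tmul, LinearMap.id_apply,
        Algebra.TensorProduct.tmul_mul_tmul, mul_one]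
      simp only [← TensorProduct.tmul_sum,
        antipode_beta_mul, TensorProduct.smul_tmul, mul_smul_comm]
    | add u v hu hv => simp only [map_add, add_mul, hu, hv]
  | add u v hu hv => simp only [map_add, mul_add, TensorProduct.add_tmul, hu, hv]

theorem ctrAA_under_dHead_mul (u : H ⊗[k] (H ⊗[k] H)) (t : H ⊗[k] (H ⊗[k] (H ⊗[k] H))) :
    q.ctrAA (under (q.dHead H) u * t) =
      q.ctrAA (under (consTwo k H H) (under (q.eHead H) u) * t) := by
  induction u using tensor_induction₃ k with
  | tmul a b c =>
    induction t using tensor_induction₄ k with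
    | tmul x y z w =>
      simp only [under_tmul, dHead_tmul, eHead_tmul, consTwo_apply, TensorProduct.tmul_sum,
        Finset.sum_mul, map_sum, map_smul, TensorProduct.tmul_smul, smul_mul_assoc, ctrAA_tmul,
        Algebra.TensorProduct.tmul_mul_tmul, one_mul, ← TensorProduct.sum_tmul,
        antipode_alpha_mul, TensorProduct.smul_tmul]
    | add u v hu hv => simp only [map_add, mul_add, hu, hv]
  | add u v hu hv => simp only [map_add, add_mul, hu, hv]

theorem ctrAA_under_consTwo_comul_mul (h : H) (t : H ⊗[k] (H ⊗[k] (H ⊗[k] H))) :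
    q.ctrAA (under (consTwo k H H) (q.comul h) * t) = q.counit h • q.ctrAA t := by
  induction t using tensor_induction₄ k with
  | tmul x y z w =>
    simp only [q.comul_eq h, under_tmul, consTwo_apply,
      Finset.sum_mul, map_sum, ctrAA_tmul,
      Algebra.TensorProduct.tmul_mul_tmul, one_mul, ← TensorProduct.tmul_sum,
      antipode_alpha_mul, TensorProduct.tmul_smul]
  | add u v hu hv => simp only [map_add, mul_add, smul_add, hu, hv]

theorem ctrBB_mul_under_dHead (u : H ⊗[k] (H ⊗[k] H)) (t : H ⊗[k] (H ⊗[k] (H ⊗[k] H))) :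
    q.ctrBB (t * under (q.dHead H) u) =
      q.ctrBB (t * under (consTwo k H H) (under (q.eHead H) u)) := by
  induction u using tensor_induction₃ k with
  | tmul a b c =>
    induction t using tensor_induction₄ k with
    | tmul x y z w =>
      simp only [under_tmul, dHead_tmul, eHead_tmul, consTwo_apply, TensorProduct.tmul_sum,
        Finset.mul_sum, map_sum, map_smul, TensorProduct.tmul_smul, mul_smul_comm, ctrBB_tmul,
        Algebra.TensorProduct.tmul_mul_tmul, mul_one]
      simp only [← TensorProduct.tmul_sum, antipode_beta_mul, TensorProduct.tmul_smul]
    | add u v hu hv => simp only [map_add, add_mul, hu, hv]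
  | add u v hu hv => simp only [map_add, mul_add, hu, hv]

theorem ctrBB_mul_under_consTwo_comul (h : H) (t : H ⊗[k] (H ⊗[k] (H ⊗[k] H))) :
    q.ctrBB (t * under (consTwo k H H) (q.comul h)) = q.counit h • q.ctrBB t := by
  induction t using tensor_induction₄ k with
  | tmul x y z w =>
    simp only [q.comul_eq h, under_tmul, consTwo_apply,
      Finset.mul_sum, map_sum, ctrBB_tmul,
      Algebra.TensorProduct.tmul_mul_tmul, mul_one, ← TensorProduct.sum_tmul,
      antipode_beta_mul, TensorProduct.smul_tmul']
  | add u v hu hv => simp only [map_add, add_mul, smul_add, hu, hv]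

theorem ctrBAHead_under_dHead_mul (u : H ⊗[k] (H ⊗[k] H)) (t : H ⊗[k] (H ⊗[k] (H ⊗[k] H))) :
    q.ctrBAHead (under (q.dHead H) u * t) =
      q.ctrBAHead (under (consTwo k H H) (under (q.eHead H) u) * t) := by
  induction u using tensor_induction₃ k with
  | tmul a b c =>
    induction t using tensor_induction₄ k with
    | tmul x y z w =>
      have h := congrArg (a * x * q.beta * ·) (q.antipode_alpha_mul b y z)
      simp only [Finset.mul_sum, mul_smul_comm, ← mul_assoc] at h
      simp only [under_tmul, dHead_tmul, eHead_tmul, consTwo_apply, TensorProduct.tmul_sum,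
        Finset.sum_mul, map_sum, map_smul, TensorProduct.tmul_smul, smul_mul_assoc,
        ctrBAHead_tmul, Algebra.TensorProduct.tmul_mul_tmul, one_mul, ← TensorProduct.sum_tmul,
        ← mul_assoc, h, TensorProduct.smul_tmul]
    | add u v hu hv => simp only [map_add, mul_add, hu, hv]
  | add u v hu hv => simp only [map_add, add_mul, hu, hv]

theorem ctrBAHead_mul_dHead (u : H ⊗[k] (H ⊗[k] H)) (t : H ⊗[k] (H ⊗[k] (H ⊗[k] H))) :
    q.ctrBAHead (t * q.dHead (H ⊗[k] H) u) =
      q.ctrBAHead (t * consTwo k H _ (q.eHead (H ⊗[k] H) u)) := by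
  induction u using tensor_induction₃ k with
  | tmul a b c =>
    induction t using tensor_induction₄ k with
    | tmul x y z w =>
      simp only [dHead_tmul, eHead_tmul, consTwo_apply,
        Finset.mul_sum, map_sum, map_smul, TensorProduct.tmul_smul, mul_smul_comm,
        ctrBAHead_tmul, Algebra.TensorProduct.tmul_mul_tmul, mul_one, ← TensorProduct.sum_tmul,
        ← Finset.sum_mul, antipode_beta_mul, smul_mul_assoc, TensorProduct.smul_tmul]
    | add u v hu hv => simp only [map_add, add_mul, hu, hv]
  | add u v hu hv => simp only [map_add, mul_add, hu, hv]

theorem ctrBATail_under_under_comul_mul (u : H ⊗[k] (H ⊗[k] H))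
    (t : H ⊗[k] (H ⊗[k] (H ⊗[k] H))) :
    q.ctrBATail (under (under q.comul) u * t) =
      q.ctrBATail (under (snocOne k H (H ⊗[k] H)) (under q.eLast u) * t) := by
  induction u using tensor_induction₃ k with
  | tmul a b c =>
    induction t using tensor_induction₄ k with
    | tmul x y z w =>
      have h := congrArg (b * y * q.beta * ·) (q.antipode_alpha_mul c z w)
      simp only [Finset.mul_sum, mul_smul_comm, ← mul_assoc] at h
      simp only [under_tmul, q.comul_eq c, eLast_tmul, map_smul, snocOne_apply,
        TensorProduct.tmul_sum, Finset.sum_mul, map_sum, TensorProduct.tmul_smul, smul_mul_assoc,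
        ctrBATail_tmul, Algebra.TensorProduct.one_def, Algebra.TensorProduct.tmul_mul_tmul,
        one_mul]
      simp only [← TensorProduct.tmul_sum, ← mul_assoc, h, TensorProduct.tmul_smul]
    | add u v hu hv => simp only [map_add, mul_add, hu, hv]
  | add u v hu hv => simp only [map_add, add_mul, hu, hv]

theorem ctrBATail_mul_under_dHead (u : H ⊗[k] (H ⊗[k] H)) (t : H ⊗[k] (H ⊗[k] (H ⊗[k] H))) :
    q.ctrBATail (t * under (q.dHead H) u) =
      q.ctrBATail (t * under (consTwo k H H) (under (q.eHead H) u)) := by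
  induction u using tensor_induction₃ k with
  | tmul a b c =>
    induction t using tensor_induction₄ k with
    | tmul x y z w =>
      simp only [under_tmul, dHead_tmul, eHead_tmul, consTwo_apply, TensorProduct.tmul_sum,
        Finset.mul_sum, map_sum, map_smul, TensorProduct.tmul_smul, mul_smul_comm,
        ctrBATail_tmul, Algebra.TensorProduct.tmul_mul_tmul, mul_one]
      simp only [← TensorProduct.tmul_sum,
        ← Finset.sum_mul, antipode_beta_mul, smul_mul_assoc, TensorProduct.tmul_smul]
    | add u v hu hv => simp only [map_add, add_mul, hu, hv]
  | add u v hu hv => simp only [map_add, mul_add, hu, hv]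

theorem ctrAAB_under_dHead_mul (u : H ⊗[k] (H ⊗[k] (H ⊗[k] H)))
    (t : H ⊗[k] (H ⊗[k] (H ⊗[k] (H ⊗[k] H)))) :
    q.ctrAAB (under (q.dHead (H ⊗[k] H)) u * t) =
      q.ctrAAB (under (consTwo k H _) (under (q.eHead (H ⊗[k] H)) u) * t) := by
  induction u using tensor_induction₄ k with
  | tmul a b c d =>
    induction t using tensor_induction₅ k with
    | tmul x y z w v =>
      simp only [under_tmul, dHead_tmul, eHead_tmul, consTwo_apply, TensorProduct.tmul_sum,
        Finset.sum_mul, map_sum, map_smul, TensorProduct.tmul_smul, smul_mul_assoc, ctrAAB_tmul,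
        Algebra.TensorProduct.tmul_mul_tmul, one_mul, ← TensorProduct.sum_tmul,
        antipode_alpha_mul, TensorProduct.smul_tmul]
    | add u v hu hv => simp only [map_add, mul_add, hu, hv]
  | add u v hu hv => simp only [map_add, add_mul, hu, hv]

theorem ctrAAB_mul_under_under_under_comul (u : H ⊗[k] (H ⊗[k] (H ⊗[k] H)))
    (t : H ⊗[k] (H ⊗[k] (H ⊗[k] (H ⊗[k] H)))) :
    q.ctrAAB (t * under (under (under q.comul)) u) =
      q.ctrAAB (t * under (under (snocOne k H (H ⊗[k] H))) (under (under q.eLast) u)) := by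
  induction u using tensor_induction₄ k with
  | tmul a b c d =>
    induction t using tensor_induction₅ k with
    | tmul x y z w v =>
      simp only [under_tmul, q.comul_eq d, eLast_tmul, map_smul, snocOne_apply,
        TensorProduct.tmul_sum, Finset.mul_sum, map_sum, TensorProduct.tmul_smul, mul_smul_comm,
        ctrAAB_tmul, Algebra.TensorProduct.one_def, Algebra.TensorProduct.tmul_mul_tmul,
        mul_one]
      simp only [← TensorProduct.tmul_sum]
      simp only [← Finset.mul_sum, antipode_beta_mul, mul_smul_comm, TensorProduct.tmul_smul]
    | add u v hu hv => simp only [map_add, add_mul, hu, hv]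
  | add u v hu hv => simp only [map_add, mul_add, hu, hv]

theorem ctrBAB_under_under_under_comul_mul (u : H ⊗[k] (H ⊗[k] (H ⊗[k] H)))
    (t : H ⊗[k] (H ⊗[k] (H ⊗[k] (H ⊗[k] H)))) :
    q.ctrBAB (under (under (under q.comul)) u * t) =
      q.ctrBAB (under (under (snocOne k H (H ⊗[k] H))) (under (under q.eLast) u) * t) := by
  induction u using tensor_induction₄ k with
  | tmul a b c d =>
    induction t using tensor_induction₅ k with
    | tmul x y z w v =>
      have h := congrArg (a * x * q.beta * ·) (q.antipode_alpha_mul d w v)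
      simp only [Finset.mul_sum, mul_smul_comm, ← mul_assoc] at h
      simp only [under_tmul, q.comul_eq d, eLast_tmul, map_smul, snocOne_apply,
        TensorProduct.tmul_sum, Finset.sum_mul, map_sum, TensorProduct.tmul_smul, smul_mul_assoc,
        ctrBAB_tmul, Algebra.TensorProduct.one_def, Algebra.TensorProduct.tmul_mul_tmul,
        one_mul, ← TensorProduct.sum_tmul, ← mul_assoc, h, TensorProduct.smul_tmul]
    | add u v hu hv => simp only [map_add, mul_add, hu, hv]
  | add u v hu hv => simp only [map_add, add_mul, hu, hv]

theorem ctrBAB_mul_under_dHead (u : H ⊗[k] (H ⊗[k] (H ⊗[k] H)))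
    (t : H ⊗[k] (H ⊗[k] (H ⊗[k] (H ⊗[k] H)))) :
    q.ctrBAB (t * under (q.dHead (H ⊗[k] H)) u) =
      q.ctrBAB (t * under (consTwo k H _) (under (q.eHead (H ⊗[k] H)) u)) := by
  induction u using tensor_induction₄ k with
  | tmul a b c d =>
    induction t using tensor_induction₅ k with
    | tmul x y z w v =>
      simp only [under_tmul, dHead_tmul, eHead_tmul, consTwo_apply, TensorProduct.tmul_sum,
        Finset.mul_sum, map_sum, map_smul, TensorProduct.tmul_smul, mul_smul_comm, ctrBAB_tmul,
        Algebra.TensorProduct.tmul_mul_tmul, mul_one]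
      simp only [← TensorProduct.tmul_sum, antipode_beta_mul, TensorProduct.tmul_smul]
    | add u v hu hv => simp only [map_add, add_mul, hu, hv]
  | add u v hu hv => simp only [map_add, mul_add, hu, hv]

end Sliding

section Contraction

theorem onHead_ctrA_mul_tmul (t : H ⊗[k] (H ⊗[k] H)) (x : H) (X : H ⊗[k] H) :
    onHead H q.ctrA (t * (x ⊗ₜ[k] X)) = (q.S x ⊗ₜ[k] 1) * onHead H q.ctrA t * X := by
  induction X using tensor_induction₂ k with
  | tmul y z =>
    induction t using tensor_induction₃ k with
    | tmul a b c => simp [q.S_mul, mul_assoc]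
    | add u v hu hv => simp only [map_add, add_mul, mul_add, hu, hv]
  | add u v hu hv => simp only [map_add, mul_add, TensorProduct.tmul_add, hu, hv]

theorem ctrBAHead_consOne_mul_tmul (t : H ⊗[k] (H ⊗[k] H)) (x y : H) (X : H ⊗[k] H) :
    q.ctrBAHead (consOne k H _ t * (x ⊗ₜ[k] (y ⊗ₜ[k] X))) =
      ((x * q.beta * q.S y) ⊗ₜ[k] 1) * onHead H q.ctrA t * X := by
  induction X using tensor_induction₂ k with
  | tmul z w =>
    induction t using tensor_induction₃ k with
    | tmul a b c => simp [q.S_mul, mul_assoc]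
    | add u v hu hv => simp only [map_add, add_mul, mul_add, hu, hv]
  | add u v hu hv => simp only [map_add, mul_add, TensorProduct.tmul_add, hu, hv]

theorem map_ctrB_dHead_tmul_mul (t : H ⊗[k] (H ⊗[k] H)) (x y : H) :
    TensorProduct.map LinearMap.id q.ctrB (q.dHead H (x ⊗ₜ[k] y) * t) =
      q.comul x * TensorProduct.map LinearMap.id q.ctrB t * (1 ⊗ₜ[k] q.S y) := by
  induction t using tensor_induction₃ k with
  | tmul a b c => simp [dHead_tmul, q.comul_eq x, Finset.sum_mul, q.S_mul, mul_assoc]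
  | add u v hu hv => simp only [map_add, add_mul, mul_add, hu, hv]

theorem ctrBATail_dHead_tmul_mul (t : H ⊗[k] (H ⊗[k] H)) (x y z : H) :
    q.ctrBATail (q.dHead (H ⊗[k] H) (x ⊗ₜ[k] (y ⊗ₜ[k] z)) * under (under (snocOne k H H)) t) =
      q.comul x * TensorProduct.map LinearMap.id q.ctrB t *
        (1 ⊗ₜ[k] (q.S y * q.alpha * z)) := by
  induction t using tensor_induction₃ k with
  | tmul a b c => simp [dHead_tmul, q.comul_eq x, Finset.sum_mul, q.S_mul, mul_assoc]
  | add u v hu hv => simp only [map_add, add_mul, mul_add, hu, hv]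

theorem ctrAA_mul_dHead_tmul (t : H ⊗[k] (H ⊗[k] (H ⊗[k] H))) (x : H) (X : H ⊗[k] H) :
    q.ctrAA (t * q.dHead (H ⊗[k] H) (x ⊗ₜ[k] X)) = q.scop x * q.ctrAA t * X := by
  induction X using tensor_induction₂ k with
  | tmul y z =>
    induction t using tensor_induction₄ k with
    | tmul a b c d =>
      simp [dHead_tmul, scop, Finset.sum_mul, Finset.mul_sum, q.S_mul, mul_assoc]
    | add u v hu hv => simp only [map_add, add_mul, mul_add, hu, hv]
  | add u v hu hv => simp only [map_add, mul_add, TensorProduct.tmul_add, hu, hv]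

theorem ctrBB_dHead_tmul_comul_mul (t : H ⊗[k] (H ⊗[k] (H ⊗[k] H))) (x y : H) :
    q.ctrBB (q.dHead (H ⊗[k] H) (x ⊗ₜ[k] q.comul y) * t) =
      q.comul x * q.ctrBB t * q.scop y := by
  induction t using tensor_induction₄ k with
  | tmul a b c d =>
    rw [q.comul_eq y, q.comul_eq x]
    simp [dHead_tmul, scop, Finset.sum_mul, Finset.mul_sum, q.S_mul, mul_assoc,
      TensorProduct.tmul_sum]
  | add u v hu hv => simp only [map_add, add_mul, mul_add, hu, hv]

/-- `x ⊗ y ⊗ z ↦ S(y) α z ⊗ S(x)`. -/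
def ctrQ : H ⊗[k] (H ⊗[k] H) →ₗ[k] H ⊗[k] H :=
  (TensorProduct.comm k H H).toLinearMap ∘ₗ TensorProduct.map q.S q.ctrA

@[simp] theorem ctrQ_tmul (x y z : H) :
    q.ctrQ (x ⊗ₜ[k] (y ⊗ₜ[k] z)) = (q.S y * q.alpha * z) ⊗ₜ[k] q.S x := rfl

theorem ctrAAB_mul_mul (t : H ⊗[k] (H ⊗[k] (H ⊗[k] H))) (x y z : H)
    (r : H ⊗[k] (H ⊗[k] H)) :
    q.ctrAAB (under (under (under (snocOne k H H))) t *
        q.dHead (H ⊗[k] (H ⊗[k] H)) (x ⊗ₜ[k] q.dHead H (y ⊗ₜ[k] z)) * consTwo k H _ r) =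
      q.scop x * q.ctrAA t * q.comul y * TensorProduct.map LinearMap.id q.ctrB r *
        (1 ⊗ₜ[k] q.S z) := by
  induction t using tensor_induction₄ k with
  | tmul a b c d =>
    induction r using tensor_induction₃ k with
    | tmul e f g =>
      rw [q.comul_eq y]
      simp [dHead_tmul, scop, Finset.sum_mul, Finset.mul_sum, q.S_mul, mul_assoc,
        TensorProduct.tmul_sum]
    | add u v hu hv => simp only [map_add, add_mul, mul_add, hu, hv]
  | add u v hu hv => simp only [map_add, add_mul, mul_add, hu, hv]

theorem ctrBAB_mul_mul (t : H ⊗[k] (H ⊗[k] (H ⊗[k] H))) (x y z : H)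
    (r : H ⊗[k] (H ⊗[k] H)) :
    q.ctrBAB (consTwo k H _ r *
        q.dHead (H ⊗[k] (H ⊗[k] H)) (x ⊗ₜ[k] q.dHead H (y ⊗ₜ[k] z)) *
          under (under (under (snocOne k H H))) t) =
      q.comul x * q.ctrBB t * q.scop y * q.ctrQ r * (z ⊗ₜ[k] 1) := by
  induction t using tensor_induction₄ k with
  | tmul a b c d =>
    induction r using tensor_induction₃ k with
    | tmul e f g =>
      rw [q.comul_eq x]
      simp [dHead_tmul, scop, Finset.sum_mul, Finset.mul_sum, q.S_mul, mul_assoc,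
        TensorProduct.tmul_sum]
    | add u v hu hv => simp only [map_add, add_mul, mul_add, hu, hv]
  | add u v hu hv => simp only [map_add, add_mul, mul_add, hu, hv]

theorem onHead_ctrA_PhiInv : onHead H q.ctrA q.PhiInv = q.qLE := by
  simp [PhiInv, qLE, qL1, qL2]

theorem map_ctrB_PhiInv : TensorProduct.map LinearMap.id q.ctrB q.PhiInv = q.pRE := by
  simp [PhiInv, pRE, pR1, pR2]

theorem ctrAA_PhiInv_mul_Phi :
    q.ctrAA (consOne k H _ q.PhiInv * under (under q.comul) q.Phi) = q.aEl := by
  simp [PhiInv, Phi, aEl, q.comul_eq, TensorProduct.tmul_sum, Finset.sum_mul, Finset.mul_sum,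
    mul_assoc]
  exact Finset.sum_congr rfl fun a _ ↦ Finset.sum_comm

theorem ctrBB_Phi_mul_PhiInv :
    q.ctrBB (q.dHead (H ⊗[k] H) q.Phi * under (under (snocOne k H H)) q.PhiInv) = q.bEl := by
  simp [PhiInv, Phi, bEl, dHead_tmul, Finset.sum_mul, Finset.mul_sum, mul_assoc]
  exact Finset.sum_comm

end Contraction

section Swap

@[simp] theorem sswap_tmul (x y : H) : q.sswap (x ⊗ₜ[k] y) = q.S y ⊗ₜ[k] q.S x := rfl

@[simp] theorem sswapInv_tmul (x y : H) :
    q.sswapInv (x ⊗ₜ[k] y) = q.Sinv y ⊗ₜ[k] q.Sinv x := rfl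

theorem sswap_comul (x : H) : q.sswap (q.comul x) = q.scop x := by
  simp [q.comul_eq x, scop]

theorem sswapInv_sswap (u : H ⊗[k] H) : q.sswapInv (q.sswap u) = u := by
  induction u using tensor_induction₂ k with
  | tmul a b => simp [q.Sinv_S]
  | add u v hu hv => simp only [map_add, hu, hv]

theorem sswap_sswapInv (u : H ⊗[k] H) : q.sswap (q.sswapInv u) = u := by
  induction u using tensor_induction₂ k with
  | tmul a b => simp [q.S_Sinv]
  | add u v hu hv => simp only [map_add, hu, hv]

theorem sswap_mul (u v : H ⊗[k] H) : q.sswap (u * v) = q.sswap v * q.sswap u := by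
  induction u using tensor_induction₂ k with
  | tmul a b =>
    induction v using tensor_induction₂ k with
    | tmul c d => simp [q.S_mul]
    | add u v hu hv => simp only [map_add, mul_add, add_mul, hu, hv]
  | add u v hu hv => simp only [map_add, mul_add, add_mul, hu, hv]

theorem scop_mul (x y : H) : q.scop (x * y) = q.scop y * q.scop x := by
  simp only [← sswap_comul, map_mul, sswap_mul]

theorem sswap_qRE : q.sswap q.qRE = q.ctrQ q.Phi := by
  simp [qRE, qR1, qR2, Phi, q.S_mul, q.S_Sinv, mul_assoc]

end Swap

section Pentagon

/-- The associator as a unit. -/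
def phiUnit : (H ⊗[k] (H ⊗[k] H))ˣ := ⟨q.Phi, q.PhiInv, q.Phi_mul_PhiInv, q.PhiInv_mul_Phi⟩

theorem pentagon_units :
    Units.map (under (under q.comul) : _ →ₐ[k] _).toMonoidHom q.phiUnit *
        Units.map (q.dHead (H ⊗[k] H)).toMonoidHom q.phiUnit =
      Units.map (consOne k H (H ⊗[k] (H ⊗[k] H))).toMonoidHom q.phiUnit *
        Units.map (under (q.dHead H) : _ →ₐ[k] _).toMonoidHom q.phiUnit *
        Units.map (under (under (snocOne k H H)) : _ →ₐ[k] _).toMonoidHom q.phiUnit :=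
  Units.ext q.pentagon_Phi

theorem consOne_PhiInv_mul :
    consOne k H _ q.PhiInv * under (under q.comul) q.Phi =
      under (q.dHead H) q.Phi * under (under (snocOne k H H)) q.Phi *
        q.dHead (H ⊗[k] H) q.PhiInv := by
  have h := q.pentagon_units
  rw [mul_assoc, ← inv_mul_eq_iff_eq_mul, ← mul_assoc, ← eq_mul_inv_iff_mul_eq] at h
  exact congrArg Units.val h

theorem dHead_Phi_mul :
    q.dHead (H ⊗[k] H) q.Phi * under (under (snocOne k H H)) q.PhiInv =
      under (under q.comul) q.PhiInv * (consOne k H _ q.Phi * under (q.dHead H) q.Phi) := by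
  have h := q.pentagon_units
  rw [← mul_inv_eq_iff_eq_mul, mul_assoc, ← eq_inv_mul_iff_mul_eq] at h
  exact congrArg Units.val h

theorem under_under_snocOne_Phi_mul :
    under (under (snocOne k H H)) q.Phi * q.dHead (H ⊗[k] H) q.PhiInv =
      under (q.dHead H) q.PhiInv * (consOne k H _ q.PhiInv * under (under q.comul) q.Phi) := by
  have h := q.pentagon_units
  rw [mul_assoc, ← inv_mul_eq_iff_eq_mul, ← inv_mul_eq_iff_eq_mul, ← mul_assoc, ← mul_assoc,
    ← eq_mul_inv_iff_mul_eq] at h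
  rw [← mul_assoc]
  exact (congrArg Units.val h).symm

theorem pentagon_PhiInv :
    under (under (snocOne k H H)) q.PhiInv * under (q.dHead H) q.PhiInv *
        consOne k H _ q.PhiInv =
      q.dHead (H ⊗[k] H) q.PhiInv * under (under q.comul) q.PhiInv := by
  have h := congrArg (·⁻¹) q.pentagon_units
  simp only [mul_inv_rev, ← mul_assoc] at h
  exact (congrArg Units.val h).symm

variable {M N : Type} [Ring M] [Algebra k M] [Ring N] [Algebra k N]

theorem consOne_mul_under {g g' : M →ₐ[k] N} {c : N} (h : ∀ m, c * g m = g' m * c)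
    (u : H ⊗[k] M) :
    consOne k H N c * under g u = under g' u * consOne k H N c := by
  induction u using TensorProduct.induction_on with
  | zero => simp
  | tmul x m => simp [h]
  | add u v hu hv => simp only [map_add, mul_add, add_mul, hu, hv]

theorem dHead_dHead_tmul (x : H) (m : M) :
    q.dHead (H ⊗[k] M) (q.dHead M (x ⊗ₜ[k] m)) =
      under (under (snocOne k H M)) (q.dHead H (q.comul x)) *
        (1 ⊗ₜ[k] (1 ⊗ₜ[k] (1 ⊗ₜ[k] m))) := by
  rw [q.comul_eq]
  simp [dHead_tmul, Finset.sum_mul]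

theorem under_dHead_dHead_tmul (x : H) (m : M) :
    under (q.dHead M) (q.dHead M (x ⊗ₜ[k] m)) =
      under (under (snocOne k H M)) (under q.comul (q.comul x)) *
        (1 ⊗ₜ[k] (1 ⊗ₜ[k] (1 ⊗ₜ[k] m))) := by
  rw [q.comul_eq x]
  simp [dHead_tmul, q.comul_eq, Finset.sum_mul, TensorProduct.tmul_sum]

theorem commute_under_under_snocOne (t : H ⊗[k] (H ⊗[k] H)) (m : M) :
    Commute (under (under (snocOne k H M)) t) (1 ⊗ₜ[k] (1 ⊗ₜ[k] (1 ⊗ₜ[k] m))) := by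
  induction t using tensor_induction₃ k with
  | tmul a b c => simp [Commute, SemiconjBy]
  | add u v hu hv => rw [map_add]; exact hu.add_left hv

theorem dHead_dHead_mul (u : H ⊗[k] M) :
    under (under (snocOne k H M)) q.PhiInv * under (q.dHead M) (q.dHead M u) =
      q.dHead (H ⊗[k] M) (q.dHead M u) * under (under (snocOne k H M)) q.PhiInv := by
  induction u using TensorProduct.induction_on with
  | zero => simp
  | tmul x m =>
    rw [dHead_dHead_tmul, under_dHead_dHead_tmul, mul_assoc _ _ (under _ _),
      ← (commute_under_under_snocOne q.PhiInv m).eq, ← mul_assoc, ← mul_assoc, ← map_mul,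
      ← map_mul, PhiInv_mul_under_comul]
  | add u v hu hv => simp only [map_add, mul_add, add_mul, hu, hv]

end Pentagon

section Twist

theorem sum_antipode_qLE_comul (x : H) :
    ∑ i ∈ Finset.range (q.n x), (q.S (q.d1 x i) ⊗ₜ[k] 1) * q.qLE * q.comul (q.d2 x i) =
      (1 ⊗ₜ[k] x) * q.qLE := by
  have h := congrArg (onHead H q.ctrA) (q.PhiInv_mul_under_comul x)
  rw [onHead_ctrA_dHead_mul, eHead_comul, onHead_ctrA_PhiInv, q.comul_eq x] at h
  simpa only [map_sum, under_tmul, Finset.mul_sum, onHead_ctrA_mul_tmul, onHead_ctrA_PhiInv]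
    using h

theorem sum_comul_pRE_antipode (x : H) :
    ∑ i ∈ Finset.range (q.n x), q.comul (q.d1 x i) * q.pRE * (1 ⊗ₜ[k] q.S (q.d2 x i)) =
      q.pRE * (x ⊗ₜ[k] 1) := by
  have h := congrArg (TensorProduct.map LinearMap.id q.ctrB) (q.PhiInv_mul_under_comul x)
  rw [map_ctrB_mul_under_comul, eLast_comul, map_ctrB_PhiInv, q.comul_eq x] at h
  simpa only [map_sum, Finset.sum_mul, map_ctrB_dHead_tmul_mul, map_ctrB_PhiInv] using h.symm

theorem sum_beta_qLE_comul :
    ∑ a ∈ Finset.range q.np, ((q.P1 a * q.beta * q.S (q.P2 a)) ⊗ₜ[k] 1) * q.qLE *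
      q.comul (q.P3 a) = 1 := by
  have h := congrArg q.ctrBAHead q.consOne_PhiInv_mul
  rw [mul_assoc, ctrBAHead_under_dHead_mul, under_eHead_Phi, map_one, one_mul,
    ctrBAHead_mul_dHead, q.map_PhiInv_eq_one _ q.eHead_Phi, map_one, mul_one] at h
  have h' : q.ctrBAHead (under (under (snocOne k H H)) q.Phi) = 1 := by
    simp [Phi, ← TensorProduct.sum_tmul, q.nondeg_1, Algebra.TensorProduct.one_def]
  rw [h', Phi] at h
  simpa only [map_sum, under_tmul, Finset.mul_sum, ctrBAHead_consOne_mul_tmul,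
    onHead_ctrA_PhiInv] using h

theorem sum_comul_pRE_alpha :
    ∑ a ∈ Finset.range q.np, q.comul (q.P1 a) * q.pRE *
      (1 ⊗ₜ[k] (q.S (q.P2 a) * q.alpha * q.P3 a)) = 1 := by
  have h := congrArg q.ctrBATail q.dHead_Phi_mul
  rw [ctrBATail_under_under_comul_mul, q.map_PhiInv_eq_one _ q.under_eLast_Phi, map_one, one_mul,
    ctrBATail_mul_under_dHead, under_eHead_Phi, map_one, mul_one] at h
  have h' : q.ctrBATail (consOne k H _ q.Phi) = 1 := by
    simp [Phi]
    simp [← TensorProduct.tmul_sum, q.nondeg_1, Algebra.TensorProduct.one_def]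
  rw [h', Phi] at h
  simpa only [map_sum, Finset.sum_mul, ctrBATail_dHead_tmul_mul, map_ctrB_PhiInv] using h

/-- `x ⊗ y ↦ (S ⊗ S)(Δ^cop x) · 𝕒 · Δ(y)`. -/
def twistMap : H ⊗[k] H →ₗ[k] H ⊗[k] H :=
  LinearMap.mul' k (H ⊗[k] H) ∘ₗ
    TensorProduct.map (LinearMap.mulRight k q.aEl ∘ₗ q.sswap ∘ₗ q.comul.toLinearMap)
      q.comul.toLinearMap

@[simp] theorem twistMap_tmul (x y : H) :
    q.twistMap (x ⊗ₜ[k] y) = q.scop x * q.aEl * q.comul y := by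
  simp [twistMap, sswap_comul]

/-- `x ⊗ y ↦ Δ(x) · 𝕓 · (S ⊗ S)(Δ^cop y)`. -/
def twistInvMap : H ⊗[k] H →ₗ[k] H ⊗[k] H :=
  LinearMap.mul' k (H ⊗[k] H) ∘ₗ
    TensorProduct.map (LinearMap.mulRight k q.bEl ∘ₗ q.comul.toLinearMap)
      (q.sswap ∘ₗ q.comul.toLinearMap)

@[simp] theorem twistInvMap_tmul (x y : H) :
    q.twistInvMap (x ⊗ₜ[k] y) = q.comul x * q.bEl * q.scop y := by
  simp [twistInvMap, sswap_comul]

theorem scop_one : q.scop 1 = 1 := by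
  simp [← sswap_comul, Algebra.TensorProduct.one_def, q.S_one]

theorem twistMap_one : q.twistMap 1 = q.aEl := by
  rw [Algebra.TensorProduct.one_def, twistMap_tmul, scop_one, map_one, one_mul, mul_one]

theorem twistInvMap_one : q.twistInvMap 1 = q.bEl := by
  rw [Algebra.TensorProduct.one_def, twistInvMap_tmul, scop_one, map_one, one_mul, mul_one]

theorem twistMap_pRE : q.twistMap q.pRE = q.twist := by
  simp [pRE, twist]

theorem twistInvMap_qLE : q.twistInvMap q.qLE = q.twistInv := by
  simp [qLE, twistInv]

theorem twistMap_mul_tmul (t : H ⊗[k] H) (x y : H) :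
    q.twistMap (t * (x ⊗ₜ[k] y)) = q.scop x * q.twistMap t * q.comul y := by
  induction t using tensor_induction₂ k with
  | tmul a b => simp [scop_mul, mul_assoc]
  | add u v hu hv => simp only [map_add, mul_add, add_mul, hu, hv]

theorem twistInvMap_tmul_mul (t : H ⊗[k] H) (x y : H) :
    q.twistInvMap ((x ⊗ₜ[k] y) * t) = q.comul x * q.twistInvMap t * q.scop y := by
  induction t using tensor_induction₂ k with
  | tmul a b => simp [scop_mul, mul_assoc]
  | add u v hu hv => simp only [map_add, mul_add, add_mul, hu, hv]

theorem twistMap_comul (x : H) : q.twistMap (q.comul x) = q.counit x • q.aEl := by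
  have h : q.twistMap (q.comul x) =
      q.ctrAA (consOne k H _ q.PhiInv * under (under q.comul) q.Phi *
        q.dHead (H ⊗[k] H) (under q.comul (q.comul x))) := by
    rw [q.comul_eq x]
    simp only [map_sum, under_tmul, Finset.mul_sum, ctrAA_mul_dHead_tmul, ctrAA_PhiInv_mul_Phi,
      twistMap_tmul]
  have h' : consOne k H _ q.PhiInv * under (under q.comul) (under q.comul (q.comul x)) =
      under (q.dHead H) (under q.comul (q.comul x)) * consOne k H _ q.PhiInv := by
    have := consOne_mul_under (g := (under q.comul).comp q.comul)
      (g' := (q.dHead H).comp q.comul) q.PhiInv_mul_under_comul (q.comul x)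
    rw [q.comul_eq x] at this ⊢
    simpa only [map_sum, under_tmul, AlgHom.comp_apply] using this
  rw [h, dHead_under, mul_assoc, ← map_mul (under (under q.comul)), Phi_mul_dHead,
    map_mul (under (under q.comul)), ← mul_assoc, h', mul_assoc, ctrAA_under_dHead_mul,
    under_under_eq_self q.eHead_comul, ctrAA_under_consTwo_comul_mul, ctrAA_PhiInv_mul_Phi]

theorem twistInvMap_comul (x : H) : q.twistInvMap (q.comul x) = q.counit x • q.bEl := by
  have h : q.twistInvMap (q.comul x) =
      q.ctrBB (q.dHead (H ⊗[k] H) (under q.comul (q.comul x)) *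
        (q.dHead (H ⊗[k] H) q.Phi * under (under (snocOne k H H)) q.PhiInv)) := by
    rw [q.comul_eq x]
    simp only [map_sum, under_tmul, Finset.sum_mul, ctrBB_dHead_tmul_comul_mul,
      ctrBB_Phi_mul_PhiInv, twistInvMap_tmul]
  rw [h, ← mul_assoc, ← map_mul (q.dHead (H ⊗[k] H)),
    ← Phi_mul_dHead, map_mul (q.dHead (H ⊗[k] H)), mul_assoc, ← dHead_dHead_mul,
    ← mul_assoc, ctrBB_mul_under_dHead, under_eHead_dHead, ctrBB_mul_under_consTwo_comul,
    ctrBB_Phi_mul_PhiInv]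

theorem twistMap_comul_mul (x : H) (t : H ⊗[k] H) :
    q.twistMap (q.comul x * t) = q.counit x • q.twistMap t := by
  induction t using tensor_induction₂ k with
  | tmul a b => simp [twistMap_mul_tmul, twistMap_comul]
  | add u v hu hv => simp only [map_add, mul_add, smul_add, hu, hv]

theorem twistInvMap_mul_comul (x : H) (t : H ⊗[k] H) :
    q.twistInvMap (t * q.comul x) = q.counit x • q.twistInvMap t := by
  induction t using tensor_induction₂ k with
  | tmul a b => simp [twistInvMap_tmul_mul, twistInvMap_comul]
  | add u v hu hv => simp only [map_add, add_mul, smul_add, hu, hv]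

theorem twist_mul_comul_S (x : H) : q.twist * q.comul (q.S x) = q.scop x * q.twist := by
  have h := congrArg q.twistMap (q.sum_comul_pRE_antipode x)
  simp only [map_sum, mul_assoc, twistMap_comul_mul, twistMap_mul_tmul, twistMap_pRE, map_one,
    mul_one, scop_one, one_mul] at h
  conv_lhs => rw [← q.counit_left x]
  simpa [Finset.mul_sum] using h

theorem comul_S_mul_twistInv (x : H) :
    q.comul (q.S x) * q.twistInv = q.twistInv * q.scop x := by
  have h := congrArg q.twistInvMap (q.sum_antipode_qLE_comul x)
  simp only [map_sum, twistInvMap_mul_comul, twistInvMap_tmul_mul, twistInvMap_qLE, map_one,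
    mul_one, scop_one, one_mul] at h
  conv_lhs => rw [← q.counit_right x]
  simpa [Finset.sum_mul] using h

theorem twist_mul_comul_alpha : q.twist * q.comul q.alpha = q.aEl := by
  have h := congrArg q.twistMap q.sum_comul_pRE_alpha
  simp only [map_sum, mul_assoc, twistMap_comul_mul, twistMap_mul_tmul, twistMap_pRE,
    scop_one, one_mul, twistMap_one] at h
  have h' := congrArg q.ctrA q.eHead_Phi
  simp only [Phi, map_sum, eHead_tmul, map_smul, ctrA_tmul, Algebra.TensorProduct.one_def,
    q.S_one, one_mul, mul_one] at h'
  rw [← h]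
  conv_lhs => rw [← h']
  simp [Finset.mul_sum, mul_assoc]

theorem comul_beta_mul_twistInv : q.comul q.beta * q.twistInv = q.bEl := by
  have h := congrArg q.twistInvMap q.sum_beta_qLE_comul
  simp only [map_sum, twistInvMap_mul_comul, twistInvMap_tmul_mul, twistInvMap_qLE,
    scop_one, mul_one, twistInvMap_one] at h
  have h' := congrArg q.ctrB q.under_eLast_Phi
  simp only [Phi, map_sum, under_tmul, eLast_tmul, TensorProduct.tmul_smul, map_smul, ctrB_tmul,
    Algebra.TensorProduct.one_def, q.S_one, one_mul, mul_one] at h'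
  rw [← h]
  conv_lhs => rw [← h']
  simp [Finset.sum_mul]

end Twist

section Transfer

theorem ctrBAB_mul_under_consTwo (t r : H ⊗[k] (H ⊗[k] H)) :
    q.ctrBAB (under (under (snocOne k H (H ⊗[k] H))) t * under (consTwo k H (H ⊗[k] H)) r) =
      TensorProduct.map LinearMap.id q.ctrB t *
        (q.mulAlpha (onHead H q.ctrB r) ⊗ₜ[k] 1) := by
  induction t using tensor_induction₃ k with
  | tmul a b c =>
    induction r using tensor_induction₃ k with
    | tmul x y z => simp [Algebra.TensorProduct.one_def, mul_assoc]
    | add u v hu hv => simp only [map_add, mul_add, TensorProduct.add_tmul, hu, hv]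
  | add u v hu hv => simp only [map_add, add_mul, hu, hv]

theorem ctrAAB_under_consTwo_mul (t r : H ⊗[k] (H ⊗[k] H)) :
    q.ctrAAB (under (consTwo k H (H ⊗[k] H)) t * under (under (snocOne k H (H ⊗[k] H))) r) =
      q.ctrQ r * (1 ⊗ₜ[k] q.ctrA (TensorProduct.map LinearMap.id q.ctrB t)) := by
  induction t using tensor_induction₃ k with
  | tmul a b c =>
    induction r using tensor_induction₃ k with
    | tmul x y z => simp [Algebra.TensorProduct.one_def, q.S_mul, mul_assoc]
    | add u v hu hv => simp only [map_add, mul_add, add_mul, hu, hv]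
  | add u v hu hv => simp only [map_add, mul_add, add_mul, TensorProduct.tmul_add, hu, hv]

theorem mulAlpha_onHead_ctrB_Phi : q.mulAlpha (onHead H q.ctrB q.Phi) = 1 := by
  simpa [Phi] using q.nondeg_1

theorem ctrA_map_ctrB_PhiInv :
    q.ctrA (TensorProduct.map LinearMap.id q.ctrB q.PhiInv) = 1 := by
  simpa [PhiInv, mul_assoc] using q.nondeg_2

theorem dHead_consOne {M : Type} [Ring M] [Algebra k M] (m : M) :
    q.dHead M (consOne k H M m) = consTwo k H M m := by
  simp [dHead, Algebra.TensorProduct.one_def]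

theorem under_under_under_snocOne (t : H ⊗[k] (H ⊗[k] H)) :
    under (under (under (snocOne k H H))) (under (under (snocOne k H H)) t) =
      under (under (snocOne k H (H ⊗[k] H))) t := by
  induction t using tensor_induction₃ k with
  | tmul a b c => simp [Algebra.TensorProduct.one_def]
  | add u v hu hv => simp only [map_add, hu, hv]

theorem under_under_dHead_snocOne (t : H ⊗[k] (H ⊗[k] H)) :
    under (under (under (snocOne k H H))) (under (under q.comul) t) =
      under (under (q.dHead H)) (under (under (snocOne k H H)) t) := by
  induction t using tensor_induction₃ k with
  | tmul a b c => simp [dHead_tmul, q.comul_eq c]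
  | add u v hu hv => simp only [map_add, hu, hv]

theorem consTwo_PhiInv_mul (t : H ⊗[k] (H ⊗[k] H)) :
    under (under (q.dHead H)) (under (under q.comul) t) * consTwo k H _ q.PhiInv =
      consTwo k H _ q.PhiInv * under (under (under q.comul)) (under (under q.comul) t) := by
  induction t using tensor_induction₃ k with
  | tmul a b c => simp [PhiInv_mul_under_comul]
  | add u v hu hv => simp only [map_add, mul_add, add_mul, hu, hv]

theorem consOne_snocOne_PhiInv_mul (t : H ⊗[k] (H ⊗[k] H)) :
    consOne k H _ (under (under (snocOne k H H)) q.PhiInv) *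
        under (under (q.dHead H)) (under (q.dHead H) t) =
      under (q.dHead (H ⊗[k] H)) (under (q.dHead H) t) *
        consOne k H _ (under (under (snocOne k H H)) q.PhiInv) := by
  induction t using TensorProduct.induction_on with
  | zero => simp
  | tmul a m => simp [dHead_dHead_mul]
  | add u v hu hv => simp only [map_add, mul_add, add_mul, hu, hv]

theorem sum_comul_bEl_scop :
    ∑ e ∈ Finset.range q.np, q.comul (q.P1 e) * q.bEl * q.scop (q.P2 e) * q.ctrQ q.Phi *
      (q.P3 e ⊗ₜ[k] 1) = q.pRE := by
  have h₁ : ∑ e ∈ Finset.range q.np, q.comul (q.P1 e) * q.bEl * q.scop (q.P2 e) *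
      q.ctrQ q.Phi * (q.P3 e ⊗ₜ[k] 1) =
      q.ctrBAB (consTwo k H _ q.Phi * q.dHead _ (under (q.dHead H) q.Phi) *
        under (under (under (snocOne k H H)))
          (q.dHead _ q.Phi * under (under (snocOne k H H)) q.PhiInv)) := by
    conv_rhs => rw [show under (q.dHead H) q.Phi = ∑ a ∈ Finset.range q.np,
      q.P1 a ⊗ₜ[k] q.dHead H (q.P2 a ⊗ₜ[k] q.P3 a) by simp [Phi]]
    simp only [map_sum, Finset.mul_sum, Finset.sum_mul, ctrBAB_mul_mul, ctrBB_Phi_mul_PhiInv]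
  rw [h₁, ← dHead_consOne, map_mul (under (under (under (snocOne k H H)))),
    under_under_under_snocOne, ← dHead_under, ← mul_assoc,
    ← map_mul (q.dHead _), ← map_mul (q.dHead _), ← pentagon_Phi, map_mul (q.dHead _),
    dHead_under, mul_assoc, ← dHead_dHead_mul, ctrBAB_under_under_under_comul_mul,
    ← dHead_under, under_eLast_Phi, map_one, map_one, one_mul, ctrBAB_mul_under_dHead,
    under_eHead_dHead, ctrBAB_mul_under_consTwo, mulAlpha_onHead_ctrB_Phi, map_ctrB_PhiInv,
    ← Algebra.TensorProduct.one_def, mul_one]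

theorem sum_scop_aEl_comul :
    ∑ b ∈ Finset.range q.nq, q.scop (q.Q1 b) * q.aEl * q.comul (q.Q2 b) * q.pRE *
      (1 ⊗ₜ[k] q.S (q.Q3 b)) = q.ctrQ q.Phi := by
  have h₁ : ∑ b ∈ Finset.range q.nq, q.scop (q.Q1 b) * q.aEl * q.comul (q.Q2 b) * q.pRE *
      (1 ⊗ₜ[k] q.S (q.Q3 b)) =
      q.ctrAAB (under (under (under (snocOne k H H)))
          (consOne k H _ q.PhiInv * under (under q.comul) q.Phi) *
        q.dHead _ (under (q.dHead H) q.PhiInv) * consTwo k H _ q.PhiInv) := by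
    conv_rhs => rw [show under (q.dHead H) q.PhiInv = ∑ b ∈ Finset.range q.nq,
      q.Q1 b ⊗ₜ[k] q.dHead H (q.Q2 b ⊗ₜ[k] q.Q3 b) by simp [PhiInv]]
    simp only [map_sum, Finset.mul_sum, Finset.sum_mul, ctrAAB_mul_mul, ctrAA_PhiInv_mul_Phi,
      map_ctrB_PhiInv]
  have h₂ : under (under (under (snocOne k H H)))
        (consOne k H _ q.PhiInv * under (under q.comul) q.Phi) *
        q.dHead _ (under (q.dHead H) q.PhiInv) * consTwo k H _ q.PhiInv =
      under (q.dHead _) (under (q.dHead H) q.PhiInv * consOne k H _ q.PhiInv) *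
        under (under (under q.comul))
          (consOne k H _ q.PhiInv * under (under q.comul) q.Phi) := by
    calc
      _ = consOne k H _ (under (under (snocOne k H H)) q.PhiInv) *
          under (under (q.dHead H)) (under (under (snocOne k H H)) q.Phi *
            q.dHead _ q.PhiInv) * consTwo k H _ q.PhiInv := by
        rw [map_mul, map_mul (under (under (q.dHead H))), under_under_dHead_snocOne, dHead_under,
          ← mul_assoc]
        rfl
      _ = consOne k H _ (under (under (snocOne k H H)) q.PhiInv) *
          under (under (q.dHead H)) (under (q.dHead H) q.PhiInv) *
          (consOne k H _ (under (q.dHead H) q.PhiInv) *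
          (under (under (q.dHead H)) (under (under q.comul) q.Phi) *
            consTwo k H _ q.PhiInv)) := by
        rw [under_under_snocOne_Phi_mul, map_mul, map_mul]
        simp only [mul_assoc]
        rfl
      _ = under (q.dHead _) (under (q.dHead H) q.PhiInv) *
          consOne k H _ (under (under (snocOne k H H)) q.PhiInv * under (q.dHead H) q.PhiInv *
            consOne k H _ q.PhiInv) *
          under (under (under q.comul)) (under (under q.comul) q.Phi) := by
        rw [consTwo_PhiInv_mul, consOne_snocOne_PhiInv_mul, map_mul, map_mul]
        simp only [mul_assoc]
        rfl
      _ = _ := by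
        rw [pentagon_PhiInv, map_mul, map_mul, map_mul]
        simp only [mul_assoc]
        rfl
  have h₃ : under (q.eHead _) (under (q.dHead H) q.PhiInv * consOne k H _ q.PhiInv) =
      q.PhiInv := by
    rw [map_mul, under_under_eq_self q.eHead_dHead, consOne_apply, under_tmul,
      q.map_PhiInv_eq_one _ q.eHead_Phi, ← Algebra.TensorProduct.one_def, mul_one]
  have h₄ : under (under q.eLast) (consOne k H _ q.PhiInv * under (under q.comul) q.Phi) =
      q.Phi := by
    rw [map_mul, under_under_eq_self (under_under_eq_self q.eLast_comul), consOne_apply,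
      under_tmul, q.map_PhiInv_eq_one _ q.under_eLast_Phi, ← Algebra.TensorProduct.one_def,
      one_mul]
  rw [h₁, h₂, ctrAAB_under_dHead_mul, ctrAAB_mul_under_under_under_comul, h₃, h₄,
    ctrAAB_under_consTwo_mul, ctrA_map_ctrB_PhiInv, ← Algebra.TensorProduct.one_def, mul_one]

theorem S_pL1 (e : ℕ) : q.S (q.pL1 e) = q.P1 e * q.beta * q.S (q.P2 e) := by
  simp [pL1, q.S_mul, q.S_Sinv]

theorem sum_comul_UL :
    ∑ e ∈ Finset.range q.np, q.comul (q.S (q.pL1 e)) * q.UL * (q.pL2 e ⊗ₜ[k] 1) = q.pRE := by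
  rw [← sum_comul_bEl_scop]
  refine Finset.sum_congr rfl fun e _ ↦ ?_
  rw [S_pL1, UL, sswap_qRE, pL2, ← comul_beta_mul_twistInv]
  simp only [map_mul, mul_assoc]
  rw [← mul_assoc (q.comul (q.S (q.P2 e))), comul_S_mul_twistInv]
  simp only [mul_assoc]

theorem sum_VL_comul :
    ∑ c ∈ Finset.range q.nq, (q.qL2 c ⊗ₜ[k] 1) * q.VL * q.comul (q.Sinv (q.qL1 c)) = q.qRE := by
  rw [← q.sswapInv_sswap q.qRE, sswap_qRE, ← sum_scop_aEl_comul, ← q.sswapInv_sswap (∑ c ∈ _, _)]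
  congr 1
  rw [map_sum]
  refine Finset.sum_congr rfl fun c _ ↦ ?_
  rw [sswap_mul, sswap_mul, sswap_comul, VL, sswap_sswapInv, sswap_tmul, S_one, qL2,
    ← mul_assoc, ← mul_assoc, ← twist_mul_comul_S, S_Sinv, qL1, ← twist_mul_comul_alpha,
    map_mul, map_mul, ← mul_assoc, ← mul_assoc, twist_mul_comul_S,
    mul_assoc (q.scop (q.Q1 c)) q.twist]

end Transfer

section Functional

variable (lam : H →ₗ[k] k)

@[simp] theorem hitR_tmul (x y : H) : hitR lam (x ⊗ₜ[k] y) = lam y • x := by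
  simp [hitR]

theorem hitR_mul_mul (y z : H) (t : H ⊗[k] H) :
    hitR lam ((y ⊗ₜ[k] 1) * t * (z ⊗ₜ[k] 1)) = y * hitR lam t * z := by
  induction t using tensor_induction₂ k with
  | tmul a b => simp
  | add u v hu hv => simp only [map_add, mul_add, add_mul, hu, hv]

end Functional

end QuasiHopf

/-- If `λ ∈ H*` satisfies
`V^L_1 h₍₁₎ U^L_1 ⟨λ, V^L_2 h₍₂₎ U^L_2⟩ = μ(φ̄1) ⟨λ, h S(φ̄2)⟩ φ̄3` for all `h`,
then it also satisfies
`q^R_1 h₍₁₎ p^R_1 ⟨λ, q^R_2 h₍₂₎ p^R_2⟩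
  = μ(φ̄1) ⟨λ, S̄(q^L_1) h S(φ̄2 p^L_1)⟩ q^L_2 φ̄3 p^L_2` for all `h`. -/
theorem statement6 (k H : Type) [Field k] [Ring H] [Algebra k H] (q : QuasiHopf k H)
    (mu : H →ₐ[k] k) (lam : H →ₗ[k] k)
    (hyp : ∀ h : H, hitR lam (q.VL * q.comul h * q.UL) =
      ∑ b ∈ Finset.range q.nq, (mu (q.Q1 b) * lam (h * q.S (q.Q2 b))) • q.Q3 b) :
    ∀ h : H, hitR lam (q.qRE * q.comul h * q.pRE) =
      ∑ b ∈ Finset.range q.nq, ∑ c ∈ Finset.range q.nq, ∑ e ∈ Finset.range q.np,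
        (mu (q.Q1 b) * lam (q.Sinv (q.qL1 c) * h * q.S (q.Q2 b * q.pL1 e))) •
          (q.qL2 c * q.Q3 b * q.pL2 e) := by
  intro h
  have key (c e : ℕ) : hitR lam ((q.qL2 c ⊗ₜ[k] 1) * q.VL * q.comul (q.Sinv (q.qL1 c)) *
      q.comul h * (q.comul (q.S (q.pL1 e)) * q.UL * (q.pL2 e ⊗ₜ[k] 1))) =
      ∑ b ∈ Finset.range q.nq,
        (mu (q.Q1 b) * lam (q.Sinv (q.qL1 c) * h * q.S (q.Q2 b * q.pL1 e))) •
          (q.qL2 c * q.Q3 b * q.pL2 e) := by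
    have h₁ := congrArg (q.qL2 c * · * q.pL2 e) (hyp (q.Sinv (q.qL1 c) * h * q.S (q.pL1 e)))
    simp only [← QuasiHopf.hitR_mul_mul] at h₁
    simpa only [map_mul, Finset.mul_sum, Finset.sum_mul, mul_smul_comm, smul_mul_assoc,
      q.S_mul, mul_assoc] using h₁
  rw [← q.sum_VL_comul, ← q.sum_comul_UL]
  simp only [Finset.sum_mul, Finset.mul_sum, map_sum, key]
  rw [Finset.sum_comm, Finset.sum_congr rfl fun c _ ↦ Finset.sum_comm, Finset.sum_comm]
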